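/- arXiv:1607.04702 — 3 statements merged into one kernel-verified Lean document; each statement's English description precedes it below -/
import Mathlib

section
/- Let ℋ be a complex Hilbert space with Hilbert (orthonormal) basis (e_n)_{n∈ℕ}. Then the algebraic linear span of {e_n − e_m : n, m ∈ ℕ} is dense in ℋ. -/
/-- A vector whose coefficients in an infinite Hilbert basis are all equal is zero. -/
theorem HilbertBasis.eq_zero_of_forall_inner_eq {ι 𝕜 E : Type*} [Infinite ι] [RCLike 𝕜]
    [NormedAddCommGroup E] [InnerProductSpace 𝕜 E] (b : HilbertBasis ι 𝕜 E) {x : E}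
    (hx : ∀ i j, inner 𝕜 (b i) x = inner 𝕜 (b j) x) : x = 0 := by
  have hzero (j : ι) : inner 𝕜 (b j) x = 0 := by
    have hsum : Summable fun _ : ι => ‖inner 𝕜 (b j) x‖ ^ 2 := by
      simpa only [hx _ j] using b.orthonormal.inner_products_summable x
    simpa using (summable_const_iff _).mp hsum
  refine b.repr.map_eq_zero_iff.mp (lp.ext (funext fun i => ?_))
  simpa [b.repr_apply_apply] using hzero i

/-- for a Hilbert basis `(e_n)` of a complex Hilbert space, the algebraic
linear span of `{e_n - e_m : n, m ∈ ℕ}` is dense. -/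
theorem dense_span_differences_of_hilbertBasis
    {ℋ : Type*} [NormedAddCommGroup ℋ] [InnerProductSpace ℂ ℋ] [CompleteSpace ℋ]
    (e : HilbertBasis ℕ ℂ ℋ) :
    Dense ((Submodule.span ℂ {x : ℋ | ∃ n m : ℕ, x = e n - e m} : Submodule ℂ ℋ) : Set ℋ) := by
  rw [Submodule.dense_iff_topologicalClosure_eq_top, Submodule.topologicalClosure_eq_top_iff,
    Submodule.eq_bot_iff]
  intro x hx
  refine e.eq_zero_of_forall_inner_eq fun n m => ?_
  rw [← sub_eq_zero, ← inner_sub_left]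
  exact hx _ (Submodule.subset_span ⟨n, m, rfl⟩)
end

section
/- Let ℋ be a complex Hilbert space with Hilbert (orthonormal) basis (e_j)_{j∈ℕ}, let (λ_j)_{j∈ℕ} be nonzero pairwise distinct real numbers, and let H : span{e_j} → span{e_j} be the linear map with He_j = λ_j e_j. Let K be the diagonal operator with domain D(K) = {φ ∈ ℋ : ∑_j λ_j^{-2}|⟨e_j,φ⟩|² < ∞} acting by Kφ = ∑_j λ_j^{-1}⟨e_j,φ⟩ e_j. Let S : span{e_j} → ℋ be a linear map such that for every η ∈ ℰ₀ := span{e_j − e_k : j,k ∈ ℕ} one has Sη ∈ D(K) and K(Sη) − S(Kη) = −iη. Define 𝔱[φ,ψ] := −(1/2)(⟨Sφ, K²ψ⟩ + ⟨K²φ, Sψ⟩) for φ,ψ ∈ span{e_j} (note K²φ ∈ span{e_j} for φ ∈ span{e_j}). Then for all φ,ψ in K(ℰ₀) = span{λ_j^{-1}e_j − λ_k^{-1}e_k : j,k ∈ ℕ}, one has Hφ, Hψ ∈ span{e_j} and 𝔱[Hφ,ψ] − 𝔱[φ,Hψ] = −i⟨φ,ψ⟩. -/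
open scoped InnerProductSpace

/-- The action of the diagonal operator `diag(μ)`: `φ ↦ ∑_j μ_j ⟨e_j, φ⟩ e_j`. -/
noncomputable def diagOp {ℋ : Type*} [NormedAddCommGroup ℋ] [InnerProductSpace ℂ ℋ]
    (e : HilbertBasis ℕ ℂ ℋ) (mu : ℕ → ℝ) (φ : ℋ) : ℋ :=
  ∑' j : ℕ, ((mu j : ℂ) * ⟪e j, φ⟫_ℂ) • e j

/-- The domain `{φ : ∑_j μ_j² |⟨e_j, φ⟩|² < ∞}` of the diagonal operator `diag(μ)`. -/
def diagDom {ℋ : Type*} [NormedAddCommGroup ℋ] [InnerProductSpace ℂ ℋ]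
    (e : HilbertBasis ℕ ℂ ℋ) (mu : ℕ → ℝ) : Set ℋ :=
  {φ | Summable fun j : ℕ => (mu j) ^ 2 * ‖⟪e j, φ⟫_ℂ‖ ^ 2}

/-- The sesquilinear form `𝔱[φ,ψ] = -(1/2)(⟨Sφ, K²ψ⟩ + ⟨K²φ, Sψ⟩)`, the formal
symmetrization of `-(1/2)(S H⁻² + H⁻² S)`, where `K = diag(1/λ_j)`. -/
noncomputable def uwtForm {ℋ : Type*} [NormedAddCommGroup ℋ] [InnerProductSpace ℂ ℋ]
    (e : HilbertBasis ℕ ℂ ℋ) (lam : ℕ → ℝ) (S : ℋ →ₗ[ℂ] ℋ) (φ ψ : ℋ) : ℂ :=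
  -(1 / 2 : ℂ) *
    (⟪S φ, diagOp e (fun j => (lam j)⁻¹) (diagOp e (fun j => (lam j)⁻¹) ψ)⟫_ℂ
      + ⟪diagOp e (fun j => (lam j)⁻¹) (diagOp e (fun j => (lam j)⁻¹) φ), S ψ⟫_ℂ)

section DiagonalOperator

variable {ℋ : Type*} [NormedAddCommGroup ℋ] [InnerProductSpace ℂ ℋ]
  (e : HilbertBasis ℕ ℂ ℋ)

theorem inner_hilbertBasis_diagOp [CompleteSpace ℋ] {mu : ℕ → ℝ} {x : ℋ}
    (hx : x ∈ diagDom e mu) (i : ℕ) :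
    ⟪e i, diagOp e mu x⟫_ℂ = (mu i : ℂ) * ⟪e i, x⟫_ℂ := by
  have hmem : Memℓp (fun j => (mu j : ℂ) * ⟪e j, x⟫_ℂ) 2 := by
    refine memℓp_gen ?_
    simpa [diagDom, mul_pow] using hx
  have h := e.hasSum_repr_symm ⟨_, hmem⟩
  have hd : diagOp e mu x = e.repr.symm ⟨_, hmem⟩ := h.tsum_eq
  rw [hd, ← e.repr_apply_apply, LinearIsometryEquiv.apply_symm_apply]

theorem inner_diagOp_left [CompleteSpace ℋ] {mu : ℕ → ℝ} {x y : ℋ}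
    (hx : x ∈ diagDom e mu) (hy : y ∈ diagDom e mu) :
    ⟪diagOp e mu x, y⟫_ℂ = ⟪x, diagOp e mu y⟫_ℂ := by
  rw [← e.tsum_inner_mul_inner, ← e.tsum_inner_mul_inner]
  refine tsum_congr fun j => ?_
  rw [← inner_conj_symm, inner_hilbertBasis_diagOp e hx, inner_hilbertBasis_diagOp e hy,
    map_mul, Complex.conj_ofReal, inner_conj_symm]
  ring

theorem mem_diagDom_of_finite {mu : ℕ → ℝ} {x : ℋ}
    (hx : (Function.support fun j => ⟪e j, x⟫_ℂ).Finite) : x ∈ diagDom e mu := by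
  refine summable_of_hasFiniteSupport (hx.subset fun j hj h => hj ?_)
  simp [h]

theorem finite_support_inner_diagOp [CompleteSpace ℋ] {mu : ℕ → ℝ} {x : ℋ}
    (hx : (Function.support fun j => ⟪e j, x⟫_ℂ).Finite) :
    (Function.support fun j => ⟪e j, diagOp e mu x⟫_ℂ).Finite := by
  refine hx.subset fun j hj h => hj ?_
  simp only [inner_hilbertBasis_diagOp e (mem_diagDom_of_finite e hx), h, mul_zero]

theorem finite_support_inner_of_mem_span {x : ℋ}
    (hx : x ∈ Submodule.span ℂ (Set.range e)) :
    (Function.support fun j => ⟪e j, x⟫_ℂ).Finite := by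
  induction hx using Submodule.span_induction with
  | mem x hx =>
    obtain ⟨k, rfl⟩ := hx
    refine (Set.finite_singleton k).subset fun j hj => ?_
    by_contra hjk
    exact hj (e.orthonormal.2 hjk)
  | zero => simp
  | add x y _ _ hx hy =>
    refine (hx.union hy).subset ?_
    simp only [inner_add_right]
    exact Function.support_add _ _
  | smul a x _ hx =>
    refine hx.subset fun j hj h => hj ?_
    simp only [inner_smul_right, h, mul_zero]

theorem inner_apply_of_mem_span {lam : ℕ → ℝ} {H : ℋ →ₗ[ℂ] ℋ}
    (hH : ∀ j, H (e j) = (lam j : ℂ) • e j) {x : ℋ}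
    (hx : x ∈ Submodule.span ℂ (Set.range e)) (i : ℕ) :
    ⟪e i, H x⟫_ℂ = (lam i : ℂ) * ⟪e i, x⟫_ℂ := by
  induction hx using Submodule.span_induction with
  | mem x hx =>
    obtain ⟨k, rfl⟩ := hx
    rw [hH, inner_smul_right]
    rcases eq_or_ne i k with rfl | hik
    · rfl
    · rw [e.orthonormal.2 hik, mul_zero, mul_zero]
  | zero => simp
  | add x y _ _ hx hy => rw [map_add, inner_add_right, inner_add_right, hx, hy, mul_add]
  | smul a x _ hx => rw [map_smul, inner_smul_right, inner_smul_right, hx, mul_left_comm]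

theorem diagOp_inv_apply_of_mem_span {lam : ℕ → ℝ} (hne : ∀ j, lam j ≠ 0) {H : ℋ →ₗ[ℂ] ℋ}
    (hH : ∀ j, H (e j) = (lam j : ℂ) • e j) {x : ℋ}
    (hx : x ∈ Submodule.span ℂ (Set.range e)) :
    diagOp e (fun j => (lam j)⁻¹) (H x) = x := by
  rw [diagOp, ← (e.hasSum_repr x).tsum_eq]
  refine tsum_congr fun j => ?_
  have hj : (lam j : ℂ) ≠ 0 := Complex.ofReal_ne_zero.2 (hne j)
  rw [(e.hasSum_repr x).tsum_eq, inner_apply_of_mem_span e hH hx, e.repr_apply_apply,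
    Complex.ofReal_inv, inv_mul_cancel_left₀ hj]

theorem span_inv_smul_sub_le_span_range (lam : ℕ → ℝ) :
    Submodule.span ℂ
        {x : ℋ | ∃ j k : ℕ, x = ((lam j)⁻¹ : ℂ) • e j - ((lam k)⁻¹ : ℂ) • e k} ≤
      Submodule.span ℂ (Set.range e) := by
  rw [Submodule.span_le]
  rintro _ ⟨j, k, rfl⟩
  exact sub_mem (Submodule.smul_mem _ _ (Submodule.subset_span ⟨j, rfl⟩))
    (Submodule.smul_mem _ _ (Submodule.subset_span ⟨k, rfl⟩))

theorem span_sub_le_span_range :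
    Submodule.span ℂ {x : ℋ | ∃ j k : ℕ, x = e j - e k} ≤ Submodule.span ℂ (Set.range e) := by
  rw [Submodule.span_le]
  rintro _ ⟨j, k, rfl⟩
  exact sub_mem (Submodule.subset_span ⟨j, rfl⟩) (Submodule.subset_span ⟨k, rfl⟩)

theorem apply_mem_span_sub {lam : ℕ → ℝ} (hne : ∀ j, lam j ≠ 0) {H : ℋ →ₗ[ℂ] ℋ}
    (hH : ∀ j, H (e j) = (lam j : ℂ) • e j) {x : ℋ}
    (hx : x ∈ Submodule.span ℂ
      {x : ℋ | ∃ j k : ℕ, x = ((lam j)⁻¹ : ℂ) • e j - ((lam k)⁻¹ : ℂ) • e k}) :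
    H x ∈ Submodule.span ℂ {x : ℋ | ∃ j k : ℕ, x = e j - e k} := by
  rw [← Submodule.mem_comap]
  refine Submodule.span_le.2 ?_ hx
  rintro _ ⟨j, k, rfl⟩
  refine Submodule.subset_span ⟨j, k, ?_⟩
  rw [map_sub, map_smul, map_smul, hH, hH,
    inv_smul_smul₀ (Complex.ofReal_ne_zero.2 (hne j)),
    inv_smul_smul₀ (Complex.ofReal_ne_zero.2 (hne k))]

end DiagonalOperator

/-- if `S` is a time operator of `H⁻¹ = diag(1/λ_j)` with CCR-domain
`ℰ₀ = span{e_j - e_k}`, then the form `𝔱 = -(1/2)(S H⁻² + H⁻² S)` satisfies the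
ultra-weak CCR for `H` on `K(ℰ₀) = span{λ_j⁻¹ e_j - λ_k⁻¹ e_k}`. -/
theorem uwtForm_ultra_weak_ccr
    {ℋ : Type*} [NormedAddCommGroup ℋ] [InnerProductSpace ℂ ℋ] [CompleteSpace ℋ]
    (e : HilbertBasis ℕ ℂ ℋ) (lam : ℕ → ℝ)
    (hne : ∀ j, lam j ≠ 0) (hinj : Function.Injective lam)
    (H : ℋ →ₗ[ℂ] ℋ) (hH : ∀ j, H (e j) = (lam j : ℂ) • e j)
    (S : ℋ →ₗ[ℂ] ℋ)
    (hS : ∀ η ∈ Submodule.span ℂ {x : ℋ | ∃ j k : ℕ, x = e j - e k},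
      S η ∈ diagDom e (fun j => (lam j)⁻¹) ∧
      diagOp e (fun j => (lam j)⁻¹) (S η) - S (diagOp e (fun j => (lam j)⁻¹) η)
        = -Complex.I • η) :
    ∀ φ ∈ Submodule.span ℂ
        {x : ℋ | ∃ j k : ℕ, x = ((lam j)⁻¹ : ℂ) • e j - ((lam k)⁻¹ : ℂ) • e k},
    ∀ ψ ∈ Submodule.span ℂ
        {x : ℋ | ∃ j k : ℕ, x = ((lam j)⁻¹ : ℂ) • e j - ((lam k)⁻¹ : ℂ) • e k},
      H φ ∈ Submodule.span ℂ (Set.range e) ∧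
      H ψ ∈ Submodule.span ℂ (Set.range e) ∧
      uwtForm e lam S (H φ) ψ - uwtForm e lam S φ (H ψ) = -Complex.I * ⟪φ, ψ⟫_ℂ := by
  intro φ hφ ψ hψ
  have hφe := span_inv_smul_sub_le_span_range e lam hφ
  have hψe := span_inv_smul_sub_le_span_range e lam hψ
  have hη := apply_mem_span_sub e hne hH hφ
  have hξ := apply_mem_span_sub e hne hH hψ
  have hηe := span_sub_le_span_range e hη
  have hξe := span_sub_le_span_range e hξ
  refine ⟨hηe, hξe, ?_⟩
  obtain ⟨hSη, hcη⟩ := hS _ hη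
  obtain ⟨hSξ, hcξ⟩ := hS _ hξ
  have hKη := diagOp_inv_apply_of_mem_span e hne hH hφe
  have hKξ := diagOp_inv_apply_of_mem_span e hne hH hψe
  unfold uwtForm
  rw [hKη] at hcη
  rw [hKξ] at hcξ
  rw [hKη, hKξ]
  set K := diagOp e (fun j => (lam j)⁻¹) with hK
  have hdom {x : ℋ} (hx : x ∈ Submodule.span ℂ (Set.range e)) :
      x ∈ diagDom e (fun j => (lam j)⁻¹) :=
    mem_diagDom_of_finite e (finite_support_inner_of_mem_span e hx)
  have hdomK {x : ℋ} (hx : x ∈ Submodule.span ℂ (Set.range e)) :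
      K x ∈ diagDom e (fun j => (lam j)⁻¹) :=
    mem_diagDom_of_finite e
      (finite_support_inner_diagOp e (finite_support_inner_of_mem_span e hx))
  have hSφ : S φ = K (S (H φ)) + Complex.I • H φ := by
    rw [sub_eq_iff_eq_add] at hcη
    rw [hcη]
    module
  have hSψ : S ψ = K (S (H ψ)) + Complex.I • H ψ := by
    rw [sub_eq_iff_eq_add] at hcξ
    rw [hcξ]
    module
  have h₁ : ⟪S (H φ), K (K ψ)⟫_ℂ = ⟪K (S (H φ)), K ψ⟫_ℂ :=
    (inner_diagOp_left e hSη (hdomK hψe)).symm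
  have h₂ : ⟪K (K φ), S (H ψ)⟫_ℂ = ⟪K φ, K (S (H ψ))⟫_ℂ :=
    inner_diagOp_left e (hdomK hφe) hSξ
  have h₃ : ⟪K φ, H ψ⟫_ℂ = ⟪φ, ψ⟫_ℂ := by
    rw [hK, inner_diagOp_left e (hdom hφe) (hdom hξe), ← hK, hKξ]
  have h₄ : ⟪H φ, K ψ⟫_ℂ = ⟪φ, ψ⟫_ℂ := by
    rw [hK, ← inner_diagOp_left e (hdom hηe) (hdom hψe), ← hK, hKη]
  rw [hSφ, hSψ, h₁, h₂, inner_add_left, inner_add_right, inner_smul_left, inner_smul_right,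
    h₃, h₄, Complex.conj_I]
  ring
end

section
/- Let ℋ be a complex Hilbert space with Hilbert (orthonormal) basis (f_j)_{j∈ℕ} and let ε : ℕ → ℝ be a function whose range is {E_n : n ∈ ℕ}, where E_1 < E_2 < ⋯ < 0 is a strictly increasing sequence of negative reals with lim_{n→∞} E_n = 0, and such that each fiber ε^{-1}({E_n}) is finite. Let H be the bounded self-adjoint operator on ℋ determined by Hf_j = ε(j) f_j for all j. Then there exist dense subspaces 𝒟 and ℰ of ℋ with ℰ ⊆ 𝒟 and H(ℰ) ⊆ 𝒟, and a sesquilinear map 𝔱 : 𝒟 × 𝒟 → ℂ (antilinear in the first argument, linear in the second) satisfying conj(𝔱[φ,ψ]) = 𝔱[ψ,φ] for all φ,ψ ∈ 𝒟, such that 𝔱[Hφ,ψ] − conj(𝔱[Hψ,φ]) = −i⟨φ,ψ⟩ for all φ,ψ ∈ ℰ. -/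
open scoped InnerProductSpace ComplexConjugate

section TimeOperator

variable {ℋ : Type*} [NormedAddCommGroup ℋ] [InnerProductSpace ℂ ℋ]

/-- Every set of indices is the support of the coordinates of some vector. -/
theorem HilbertBasis.exists_support_eq (f : HilbertBasis ℕ ℂ ℋ) (A : Set ℕ) :
    ∃ v : ℋ, ∀ s, ⟪f s, v⟫_ℂ ≠ 0 ↔ s ∈ A := by
  classical
  have hmem : Memℓp (fun s => if s ∈ A then ((1 / 2 : ℂ)) ^ s else 0) 2 := by
    apply memℓp_gen
    refine Summable.of_nonneg_of_le (fun _ => by positivity) (fun s => ?_)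
      summable_geometric_two
    have h : ((1 / 2 : ℝ)) ^ s ≤ 1 := pow_le_one₀ (by norm_num) (by norm_num)
    have h0 : (0 : ℝ) ≤ (1 / 2 : ℝ) ^ s := by positivity
    split_ifs
    · simp only [norm_pow, norm_div, norm_one, RCLike.norm_ofNat, ENNReal.toReal_ofNat,
        Real.rpow_ofNat]
      nlinarith
    · simp
  refine ⟨f.repr.symm ⟨_, hmem⟩, fun s => ?_⟩
  rw [← f.repr_apply_apply, LinearIsometryEquiv.apply_symm_apply]
  by_cases hs : s ∈ A <;> simp [hs]

/-- The powers of a symmetric operator act diagonally on the coordinates with respect to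
eigenvectors. -/
theorem LinearMap.IsSymmetric.inner_pow_apply_of_eigenvector {T : ℋ →ₗ[ℂ] ℋ}
    (hT : T.IsSymmetric) {u : ℋ} {a : ℝ} (hu : T u = (a : ℂ) • u) (n : ℕ) (v : ℋ) :
    ⟪u, (T ^ n) v⟫_ℂ = (a : ℂ) ^ n * ⟪u, v⟫_ℂ := by
  induction n with
  | zero => simp
  | succ n ih =>
    rw [pow_succ', Module.End.mul_apply, ← hT, hu, inner_smul_left, ih, Complex.conj_ofReal]
    ring

/-- A symmetric operator with infinitely many distinct eigenvalues on a Hilbert basis admits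
a sequence of vectors with dense span whose orbits are jointly linearly independent. -/
theorem HilbertBasis.exists_linearIndependent_orbits (f : HilbertBasis ℕ ℂ ℋ)
    {T : ℋ →ₗ[ℂ] ℋ} (hT : T.IsSymmetric) {ε : ℕ → ℝ}
    (hTf : ∀ j, T (f j) = (ε j : ℂ) • f j) {J : ℕ → ℕ} (hJ : Function.Injective (ε ∘ J)) :
    ∃ d : ℕ → ℋ, Dense (Submodule.span ℂ (Set.range d) : Set ℋ) ∧
      LinearIndependent ℂ (fun x : ℕ × ℕ => (T ^ x.2) (d x.1)) := by
  choose e he using fun k : ℕ =>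
    f.exists_support_eq (Set.range fun i => J (Nat.pair k i))
  let c : ℕ → ℝ := fun k => ((k.unpair.2 + 1 : ℝ) * (‖e k‖ + 1))⁻¹
  have hc (k : ℕ) : 0 < c k := by positivity
  have hJinj : Function.Injective J := hJ.of_comp
  let d : ℕ → ℋ := fun k => f k.unpair.1 + (c k : ℂ) • e k
  refine ⟨d, ?_, ?_⟩
  · have hf (m : ℕ) : f m ∈ (Submodule.span ℂ (Set.range d)).topologicalClosure := by
      have hlim : Filter.Tendsto (fun r => d (Nat.pair m r)) Filter.atTop (nhds (f m)) := by
        rw [tendsto_iff_norm_sub_tendsto_zero]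
        refine squeeze_zero (fun _ => norm_nonneg _) (fun r => ?_)
          (tendsto_one_div_add_atTop_nhds_zero_nat (𝕜 := ℝ))
        have hr : (0 : ℝ) < r + 1 := by positivity
        have hn := norm_nonneg (e (Nat.pair m r))
        simp only [d, c, Nat.unpair_pair, add_sub_cancel_left, norm_smul, Complex.norm_real,
          Real.norm_eq_abs]
        rw [abs_of_pos (by positivity), mul_inv, mul_assoc, one_div]
        refine mul_le_of_le_one_right (by positivity) ?_
        rw [inv_mul_le_iff₀ (by positivity)]
        linarith
      exact mem_closure_of_tendsto hlim
        (.of_forall fun r => Submodule.subset_span ⟨_, rfl⟩)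
    rw [Submodule.dense_iff_topologicalClosure_eq_top, eq_top_iff, ← f.dense_span]
    refine Submodule.topologicalClosure_minimal _ (Submodule.span_le.2 ?_)
      (Submodule.isClosed_topologicalClosure _)
    rintro _ ⟨m, rfl⟩
    exact hf m
  · rw [linearIndependent_iff']
    rintro s g hg ⟨k, n⟩ hkn
    let P : Polynomial ℂ := ∑ x ∈ s with x.1 = k, Polynomial.monomial x.2 (g x)
    have hroot (i : ℕ) (hi : ∀ x ∈ s, x.1.unpair.1 ≠ J (Nat.pair k i)) :
        P.eval (ε (J (Nat.pair k i)) : ℂ) = 0 := by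
      set j := J (Nat.pair k i)
      have hek : ⟪f j, e k⟫_ℂ ≠ 0 := (he k j).2 ⟨i, rfl⟩
      have hel (l : ℕ) (hl : l ≠ k) : ⟪f j, e l⟫_ℂ = 0 := by
        by_contra h
        obtain ⟨i', hi'⟩ := (he l j).1 h
        exact hl (Nat.pair_eq_pair.1 (hJinj hi')).1
      have hsum : ∑ x ∈ s, g x * ((ε j : ℂ) ^ x.2 * ⟪f j, d x.1⟫_ℂ) = 0 := by
        have := congrArg (fun v => ⟪f j, v⟫_ℂ) hg
        simpa only [inner_sum, inner_smul_right, inner_zero_right,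
          hT.inner_pow_apply_of_eigenvector (hTf j)] using this
      have hP : P.eval (ε j : ℂ) * (c k * ⟪f j, e k⟫_ℂ) = 0 := by
        rw [← hsum, Polynomial.eval_finsetSum, Finset.sum_mul, Finset.sum_filter]
        refine Finset.sum_congr rfl fun x hx => ?_
        have hfx : ⟪f j, f x.1.unpair.1⟫_ℂ = 0 := f.orthonormal.2 (hi x hx).symm
        simp only [d, inner_add_right, inner_smul_right, hfx, zero_add]
        split_ifs with h
        · rw [Polynomial.eval_monomial, h]
          ring
        · rw [hel _ h]
          simp
      have hck : (c k : ℂ) ≠ 0 := by exact_mod_cast (hc k).ne'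
      exact (mul_eq_zero.1 hP).resolve_right (mul_ne_zero hck hek)
    have hinj : Function.Injective fun i => J (Nat.pair k i) := fun i i' h =>
      (Nat.pair_eq_pair.1 (hJinj h)).2
    have hbad : {i | ∃ x ∈ s, x.1.unpair.1 = J (Nat.pair k i)}.Finite := by
      refine Set.Finite.subset
        ((s.image fun x => x.1.unpair.1).finite_toSet.preimage hinj.injOn) ?_
      rintro i ⟨x, hx, h⟩
      exact Finset.mem_coe.2 (Finset.mem_image.2 ⟨x, hx, h⟩)
    have hP : P = 0 := by
      refine P.eq_zero_of_infinite_isRoot (Set.Infinite.mono ?_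
        (hbad.infinite_compl.image (f := fun i => (ε (J (Nat.pair k i)) : ℂ)) ?_))
      · rintro _ ⟨i, hi, rfl⟩
        exact hroot i fun x hx h => hi ⟨x, hx, h⟩
      · intro i _ i' _ h
        exact (Nat.pair_eq_pair.1 (hJ (Complex.ofReal_injective h))).2
    have hcoeff : P.coeff n = g (k, n) := by
      simp only [P, Polynomial.finsetSum_coeff, Polynomial.coeff_monomial]
      rw [Finset.sum_eq_single (k, n)]
      · simp
      · rintro ⟨l, m⟩ hx hne
        have hl : l = k := (Finset.mem_filter.1 hx).2
        refine if_neg fun (h : m = n) => hne (by rw [hl, h])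
      · intro h
        exact (h (Finset.mem_filter.2 ⟨hkn, rfl⟩)).elim
    rw [← hcoeff, hP, Polynomial.coeff_zero]

/-- A linear map with linearly independent orbits of a family of vectors admits a formal
derivation satisfying the canonical commutation relation on the span of the orbits. -/
theorem LinearIndependent.exists_commutator_eq_one {K V ι : Type*} [Field K] [AddCommGroup V]
    [Module K V] {T : V →ₗ[K] V} {d : ι → V}
    (hli : LinearIndependent K (fun x : ι × ℕ => (T ^ x.2) (d x.1))) :
    ∃ D : V →ₗ[K] V,
      ∀ v ∈ Submodule.span K (Set.range fun x : ι × ℕ => (T ^ x.2) (d x.1)),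
        D (T v) = v + T (D v) := by
  obtain ⟨D, hD⟩ := ((Module.Basis.span hli).constr K
    fun x : ι × ℕ => (x.2 : K) • (T ^ (x.2 - 1)) (d x.1)).exists_extend
  have hDb (k : ι) (n : ℕ) : D ((T ^ n) (d k)) = (n : K) • (T ^ (n - 1)) (d k) := by
    have := (Module.Basis.span hli).constr_basis K
      (fun x : ι × ℕ => (x.2 : K) • (T ^ (x.2 - 1)) (d x.1)) (k, n)
    rw [← hD, LinearMap.comp_apply, Submodule.subtype_apply, Module.Basis.span_apply] at this
    exact this
  refine ⟨D, fun v hv => ?_⟩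
  induction hv using Submodule.span_induction with
  | mem v hv =>
    obtain ⟨⟨k, n⟩, rfl⟩ := hv
    change D (T ((T ^ n) (d k))) = (T ^ n) (d k) + T (D ((T ^ n) (d k)))
    rw [← Module.End.mul_apply T, ← pow_succ', hDb, hDb, map_smul, ← Module.End.mul_apply T,
      ← pow_succ']
    rcases n with _ | n
    · simp
    · simp only [Nat.add_sub_cancel, Nat.cast_add, Nat.cast_one]
      module
  | zero => simp
  | add v w _ _ hv hw =>
    rw [map_add, map_add, map_add, map_add, hv, hw]
    abel
  | smul a v _ hv => rw [map_smul, map_smul, map_smul, map_smul, hv, smul_add]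

end TimeOperator

/-- a bounded self-adjoint operator `H` whose eigenvector basis `(f_j)` has
eigenvalues `ε(j)` running (with finite multiplicities) through a strictly increasing
sequence of negative reals tending to `0` admits an ultra-weak time operator with dense
symmetric domain `𝒟` and dense ultra-weak CCR-domain `ℰ`. -/
theorem exists_ultra_weak_time_operator
    {ℋ : Type*} [NormedAddCommGroup ℋ] [InnerProductSpace ℂ ℋ] [CompleteSpace ℋ]
    (f : HilbertBasis ℕ ℂ ℋ) (ε : ℕ → ℝ) (E : ℕ → ℝ)
    (hmono : StrictMono E) (hneg : ∀ n, E n < 0)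
    (hlim : Filter.Tendsto E Filter.atTop (nhds 0))
    (hrange : Set.range ε = Set.range E)
    (hfib : ∀ n : ℕ, (ε ⁻¹' {E n}).Finite)
    (H : ℋ →L[ℂ] ℋ) (hsa : IsSelfAdjoint H)
    (hH : ∀ j, H (f j) = (ε j : ℂ) • f j) :
    ∃ (𝒟 ℰ : Submodule ℂ ℋ) (t : 𝒟 → 𝒟 → ℂ)
      (hℰ𝒟 : ℰ ≤ 𝒟) (hHℰ : ∀ (ψ : ℋ), ψ ∈ ℰ → H ψ ∈ 𝒟),
      Dense (𝒟 : Set ℋ) ∧ Dense (ℰ : Set ℋ) ∧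
      -- sesquilinearity: antilinear in the first argument, linear in the second
      (∀ (φ φ' ψ : 𝒟), t (φ + φ') ψ = t φ ψ + t φ' ψ) ∧
      (∀ (c : ℂ) (φ ψ : 𝒟), t (c • φ) ψ = conj c * t φ ψ) ∧
      (∀ (φ ψ ψ' : 𝒟), t φ (ψ + ψ') = t φ ψ + t φ ψ') ∧
      (∀ (c : ℂ) (φ ψ : 𝒟), t φ (c • ψ) = c * t φ ψ) ∧
      -- symmetry on 𝒟
      (∀ (φ ψ : 𝒟), conj (t φ ψ) = t ψ φ) ∧
      -- ultra-weak CCR on ℰ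
      (∀ (φ ψ : ℋ) (hφ : φ ∈ ℰ) (hψ : ψ ∈ ℰ),
        t ⟨H φ, hHℰ φ hφ⟩ ⟨ψ, hℰ𝒟 hψ⟩ - conj (t ⟨H ψ, hHℰ ψ hψ⟩ ⟨φ, hℰ𝒟 hφ⟩)
          = -Complex.I * ⟪φ, ψ⟫_ℂ) := by
  have hT : (H : ℋ →ₗ[ℂ] ℋ).IsSymmetric := hsa.isSymmetric
  have hJex (n : ℕ) : ∃ j, ε j = E n := by
    rw [← Set.mem_range, hrange]
    exact ⟨n, rfl⟩
  choose J hJ using hJex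
  obtain ⟨d, hd, hli⟩ := f.exists_linearIndependent_orbits hT hH (J := J)
    (by simpa only [Function.comp_def, hJ] using hmono.injective)
  obtain ⟨D, hD⟩ := hli.exists_commutator_eq_one
  set S := Submodule.span ℂ
    (Set.range fun x : ℕ × ℕ => ((H : ℋ →ₗ[ℂ] ℋ) ^ x.2) (d x.1))
  have hdense : Dense (S : Set ℋ) := by
    refine hd.mono (Submodule.span_mono ?_)
    rintro _ ⟨k, rfl⟩
    exact ⟨(k, 0), by simp⟩
  have hHS (ψ : ℋ) (hψ : ψ ∈ S) : H ψ ∈ S := by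
    suffices h : S ≤ S.comap (H : ℋ →ₗ[ℂ] ℋ) from h hψ
    refine Submodule.span_le.2 ?_
    rintro _ ⟨⟨k, n⟩, rfl⟩
    refine Submodule.subset_span ⟨(k, n + 1), ?_⟩
    simp only [pow_succ', Module.End.mul_apply]
  refine ⟨S, S, fun φ ψ => -(Complex.I / 2) * (⟪D φ, ψ⟫_ℂ - ⟪(φ : ℋ), D ψ⟫_ℂ), le_rfl, hHS,
    hdense, hdense, ?_, ?_, ?_, ?_, ?_, ?_⟩
  · intro φ φ' ψ
    simp only [Submodule.coe_add, map_add, inner_add_left]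
    ring
  · intro c φ ψ
    simp only [Submodule.coe_smul, map_smul, inner_smul_left]
    ring
  · intro φ ψ ψ'
    simp only [Submodule.coe_add, map_add, inner_add_right]
    ring
  · intro c φ ψ
    simp only [Submodule.coe_smul, map_smul, inner_smul_right]
    ring
  · intro φ ψ
    simp only [map_mul, map_neg, map_div₀, map_sub, Complex.conj_I, inner_conj_symm,
      Complex.conj_ofNat]
    ring
  · intro φ ψ hφ hψ
    have hDφ : D (H φ) = φ + H (D φ) := hD φ hφ
    have hDψ : D (H ψ) = ψ + H (D ψ) := hD ψ hψ
    have h₁ : ⟪H (D φ), ψ⟫_ℂ = ⟪D φ, H ψ⟫_ℂ := hT _ _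
    have h₂ : ⟪H φ, D ψ⟫_ℂ = ⟪φ, H (D ψ)⟫_ℂ := hT _ _
    simp only [map_mul, map_neg, map_div₀, map_sub, Complex.conj_I, inner_conj_symm,
      Complex.conj_ofNat, hDφ, hDψ, inner_add_left, map_add, h₁, h₂]
    ring
end
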